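/- Suppose char(F) = 0 and let G be a finite group. Then there exist non-negative integers k_0(G) and β_0(G) such that β_k(G) = k·σ(G) + β_0(G) for all k ≥ k_0(G); in particular lim_{k→∞} β_k(G)/k = σ(G). -/

import Mathlib

open scoped ENNReal


open MvPolynomial

/-- The (right) action of a group element `g` on the coordinate ring `F[V]` of `V = ι → F`,
determined by `(f^g)(v) = f (g • v)` where `g` acts on `V` through the representation `ρ`. -/
noncomputable def polyAct {F : Type*} [Field F] {G : Type*} [Group G] {ι : Type*}
    [Fintype ι] [DecidableEq ι] (ρ : Representation F G (ι → F)) (g : G) :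
    MvPolynomial ι F →ₐ[F] MvPolynomial ι F :=
  MvPolynomial.aeval (fun i => ∑ j, (ρ g (Pi.single j 1) i) • MvPolynomial.X j)

/-- The ring of polynomial invariants `F[V]^G`. -/
noncomputable def invRing {F : Type*} [Field F] {G : Type*} [Group G] {ι : Type*}
    [Fintype ι] [DecidableEq ι] (ρ : Representation F G (ι → F)) :
    Subalgebra F (MvPolynomial ι F) :=
  ⨅ g : G, AlgHom.equalizer (polyAct ρ g) (AlgHom.id F (MvPolynomial ι F))

/-- The degree `d` homogeneous component of a graded subalgebra `S` of the polynomial ring,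
as a subspace of the polynomial ring. -/
noncomputable def subComp {F : Type*} [Field F] {ι : Type*} (S : Subalgebra F (MvPolynomial ι F)) (d : ℕ) :
    Submodule F (MvPolynomial ι F) :=
  Subalgebra.toSubmodule S ⊓ homogeneousSubmodule ι F d

/-- `S_+`, the span of the homogeneous elements of positive degree of `S`. -/
noncomputable def subPos {F : Type*} [Field F] {ι : Type*} (S : Subalgebra F (MvPolynomial ι F)) :
    Submodule F (MvPolynomial ι F) :=
  ⨆ d ∈ Set.Ioi (0 : ℕ), subComp S d

/-- `β_k(S)`, the top degree of `S_+ / S_+^{k+1}`, i.e. the supremum (in `ℕ∞`) of the degrees `d`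
such that the degree `d` component of `S_+` is not contained in `S_+^{k+1}`. -/
noncomputable def betaAlg {F : Type*} [Field F] {ι : Type*}
    (S : Subalgebra F (MvPolynomial ι F)) (k : ℕ) : ℕ∞ :=
  sSup ((fun d : ℕ => (d : ℕ∞)) '' {d | 0 < d ∧ ¬ subComp S d ≤ subPos S ^ (k + 1)})

/-- `β_k(F[V], S)`, the top degree of `F[V]/S_+^k F[V]`, i.e. the supremum (in `ℕ∞`) of the
degrees `d` such that the degree `d` component of the polynomial ring is not contained in
`S_+^k ⬝ F[V]`. -/
noncomputable def betaMod {F : Type*} [Field F] {ι : Type*}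
    (S : Subalgebra F (MvPolynomial ι F)) (k : ℕ) : ℕ∞ :=
  sSup ((fun d : ℕ => (d : ℕ∞)) ''
    {d | ¬ homogeneousSubmodule ι F d ≤ subPos S ^ k * (⊤ : Submodule F (MvPolynomial ι F))})

/-- `β_k(G)`, the supremum over all finite dimensional `G`-modules `V` of `β_k(F[V]^G)`. -/
noncomputable def betaGrp (F : Type*) [Field F] (G : Type*) [Group G] (k : ℕ) : ℕ∞ :=
  ⨆ (n : ℕ) (ρ : Representation F G (Fin n → F)), betaAlg (invRing ρ) k

/-- `S` is a finitely generated module over its subalgebra `T`. -/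
noncomputable def fgOver {F : Type*} [Field F] {ι : Type*} (S T : Subalgebra F (MvPolynomial ι F)) : Prop :=
  ∃ B : Finset (MvPolynomial ι F), (B : Set (MvPolynomial ι F)) ⊆ S ∧
    Subalgebra.toSubmodule S ≤ Subalgebra.toSubmodule T * Submodule.span F (B : Set (MvPolynomial ι F))

/-- `σ(S)`: the minimal `d` such that `S` is a finitely generated module over the subalgebra
`F[S_{≤ d}]` generated by the homogeneous elements of `S` of degree at most `d`. -/
noncomputable def sigmaAlg {F : Type*} [Field F] {ι : Type*}
    (S : Subalgebra F (MvPolynomial ι F)) : ℕ :=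
  sInf {d : ℕ | fgOver S (Algebra.adjoin F (⋃ i ∈ Set.Iic d, (subComp S i : Set (MvPolynomial ι F))))}

/-- `σ(G)`, the supremum over all finite dimensional `G`-modules `V` of `σ(F[V]^G)`. -/
noncomputable def sigmaGrp (F : Type*) [Field F] (G : Type*) [Group G] : ℕ∞ :=
  ⨆ (n : ℕ) (ρ : Representation F G (Fin n → F)), (sigmaAlg (invRing ρ) : ℕ∞)

/-- An irreducible (simple, nonzero) representation. -/
def IsIrredRep {F : Type*} [Field F] {G : Type*} [Group G] {V : Type*}
    [AddCommGroup V] [Module F V] (π : Representation F G V) : Prop :=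
  Nontrivial V ∧ ∀ W : Submodule F V, (∀ g : G, ∀ x ∈ W, π g x ∈ W) → W = ⊥ ∨ W = ⊤


section Abstract

variable {F : Type*} [Field F] {ι : Type*}

/-- span of the homogeneous elements of degree in `[1, D]`. -/
noncomputable def loPart (S : Subalgebra F (MvPolynomial ι F)) (D : ℕ) :
    Submodule F (MvPolynomial ι F) :=
  ⨆ d ∈ Set.Icc 1 D, subComp S d

/-- span of the homogeneous elements of degree at least `e`. -/
noncomputable def hiPart (S : Subalgebra F (MvPolynomial ι F)) (e : ℕ) :
    Submodule F (MvPolynomial ι F) :=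
  ⨆ d ∈ Set.Ici e, subComp S d

/-- the subalgebra is graded -/
def IsGr (S : Subalgebra F (MvPolynomial ι F)) : Prop :=
  ∀ p ∈ S, ∀ d, homogeneousComponent d p ∈ S

lemma subComp_le (S : Subalgebra F (MvPolynomial ι F)) (d : ℕ) :
    subComp S d ≤ Subalgebra.toSubmodule S := inf_le_left

lemma subComp_le_hom (S : Subalgebra F (MvPolynomial ι F)) (d : ℕ) :
    subComp S d ≤ homogeneousSubmodule ι F d := inf_le_right

lemma mem_subComp {S : Subalgebra F (MvPolynomial ι F)} {d : ℕ} {p : MvPolynomial ι F} :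
    p ∈ subComp S d ↔ p ∈ S ∧ p.IsHomogeneous d := by
  simp [subComp]

lemma loPart_le (S : Subalgebra F (MvPolynomial ι F)) (D : ℕ) :
    loPart S D ≤ Subalgebra.toSubmodule S :=
  iSup₂_le fun d _ => subComp_le S d

lemma subComp_le_loPart (S : Subalgebra F (MvPolynomial ι F)) {d D : ℕ} (h1 : 1 ≤ d)
    (h : d ≤ D) : subComp S d ≤ loPart S D :=
  le_iSup₂_of_le d ⟨h1, h⟩ le_rfl

lemma subComp_le_hiPart (S : Subalgebra F (MvPolynomial ι F)) {d e : ℕ} (h1 : e ≤ d) :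
    subComp S d ≤ hiPart S e :=
  le_iSup₂_of_le d h1 le_rfl

lemma subComp_le_subPos (S : Subalgebra F (MvPolynomial ι F)) {d : ℕ} (h1 : 0 < d) :
    subComp S d ≤ subPos S :=
  le_iSup₂_of_le d h1 le_rfl

lemma subPos_le (S : Subalgebra F (MvPolynomial ι F)) :
    subPos S ≤ Subalgebra.toSubmodule S :=
  iSup₂_le fun d _ => subComp_le S d

lemma loPart_le_subPos (S : Subalgebra F (MvPolynomial ι F)) (D : ℕ) :
    loPart S D ≤ subPos S :=
  iSup₂_le fun _ hd => subComp_le_subPos S hd.1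

lemma subPos_le_sup (S : Subalgebra F (MvPolynomial ι F)) (D : ℕ) :
    subPos S ≤ loPart S D ⊔ hiPart S (D + 1) := by
  refine iSup₂_le fun d hd => ?_
  by_cases h : d ≤ D
  · exact (subComp_le_loPart S hd h).trans le_sup_left
  · exact (subComp_le_hiPart S (by omega)).trans le_sup_right

lemma subPos_eq_hiPart (S : Subalgebra F (MvPolynomial ι F)) : subPos S = hiPart S 1 := rfl

lemma subComp_mul (S : Subalgebra F (MvPolynomial ι F)) (i j : ℕ) :
    subComp S i * subComp S j ≤ subComp S (i + j) := by
  rw [Submodule.mul_le]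
  intro m hm n hn
  rw [mem_subComp] at *
  exact ⟨S.mul_mem hm.1 hn.1, hm.2.mul hn.2⟩

lemma hiPart_mul (S : Subalgebra F (MvPolynomial ι F)) (a b : ℕ) :
    hiPart S a * hiPart S b ≤ hiPart S (a + b) := by
  unfold hiPart
  simp only [Submodule.iSup_mul, Submodule.mul_iSup]
  refine iSup₂_le fun i hi => iSup₂_le fun j hj => ?_
  refine (subComp_mul S _ _).trans ?_
  simp only [Set.mem_Ici] at hi hj
  exact subComp_le_hiPart S (by omega)

lemma hiPart_pow (S : Subalgebra F (MvPolynomial ι F)) (a k : ℕ) :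
    hiPart S a ^ (k + 1) ≤ hiPart S ((k + 1) * a) := by
  induction k with
  | zero => simp
  | succ k ih =>
    rw [pow_succ]
    refine (mul_le_mul' ih le_rfl).trans ((hiPart_mul S _ _).trans ?_)
    rw [show (k + 1) * a + a = (k + 1 + 1) * a by ring]

lemma toSub_mul (S : Subalgebra F (MvPolynomial ι F)) :
    Subalgebra.toSubmodule S * Subalgebra.toSubmodule S ≤ Subalgebra.toSubmodule S := by
  rw [Submodule.mul_le]
  exact fun m hm n hn => S.mul_mem hm hn

lemma subPos_pow_succ_le (S : Subalgebra F (MvPolynomial ι F)) (k : ℕ) :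
    subPos S ^ (k + 2) ≤ subPos S ^ (k + 1) := by
  rw [pow_succ, pow_succ, mul_assoc]
  refine mul_le_mul' le_rfl ?_
  refine (hiPart_mul S 1 1).trans ?_
  refine iSup₂_le fun d hd => subComp_le_subPos S ?_
  simp only [Set.mem_Ici] at hd
  omega

lemma homComp_mul {j d : ℕ} {s t : MvPolynomial ι F} (hs : s.IsHomogeneous j) :
    homogeneousComponent d (s * t) =
      if j ≤ d then s * homogeneousComponent (d - j) t else 0 := by
  conv_lhs => rw [← sum_homogeneousComponent t, Finset.mul_sum, map_sum]
  have h1 : ∀ i, homogeneousComponent d (s * homogeneousComponent i t) =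
      if j + i = d then s * homogeneousComponent i t else 0 := by
    intro i
    have := hs.mul (homogeneousComponent_isHomogeneous i t)
    rw [homogeneousComponent_of_mem this]
    simp only [eq_comm]
  simp only [h1]
  split_ifs with h
  · have h2 : ∀ i, (j + i = d) ↔ i = d - j := by intro i; omega
    simp only [h2, Finset.sum_ite_eq', Finset.mem_range]
    split_ifs with h3
    · rfl
    · rw [homogeneousComponent_eq_zero _ _ (by omega), mul_zero]
  · refine Finset.sum_eq_zero fun i _ => if_neg (by omega)

lemma lo_mul_homComp {S : Subalgebra F (MvPolynomial ι F)} (hS : IsGr S) {D d : ℕ}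
    {X : Submodule F (MvPolynomial ι F)}
    (hX : ∀ j, 1 ≤ j → j ≤ D → j ≤ d → subComp S j * subComp S (d - j) ≤ X)
    {p : MvPolynomial ι F} (hp : p ∈ loPart S D * Subalgebra.toSubmodule S) :
    homogeneousComponent d p ∈ X := by
  have : loPart S D * Subalgebra.toSubmodule S ≤ X.comap (homogeneousComponent d) := by
    unfold loPart
    simp only [Submodule.iSup_mul]
    refine iSup₂_le fun j hj => ?_
    rw [Submodule.mul_le]
    intro s hs t ht
    rw [Submodule.mem_comap]
    have hs' := mem_subComp.1 hs
    rw [homComp_mul hs'.2]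
    split_ifs with h
    · exact hX j hj.1 hj.2 h (Submodule.mul_mem_mul hs
        (mem_subComp.2 ⟨hS t ht _, homogeneousComponent_isHomogeneous _ _⟩))
    · exact X.zero_mem
  exact this hp

lemma subComp_le_of_lo {S : Subalgebra F (MvPolynomial ι F)} (hS : IsGr S) {D d : ℕ}
    {X : Submodule F (MvPolynomial ι F)}
    (hX : ∀ j, 1 ≤ j → j ≤ D → j ≤ d → subComp S j * subComp S (d - j) ≤ X)
    (h : subComp S d ≤ loPart S D * Subalgebra.toSubmodule S) :
    subComp S d ≤ X := by
  intro p hp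
  have := lo_mul_homComp hS hX (h hp)
  rwa [homogeneousComponent_eq_self (mem_subComp.1 hp).2] at this

lemma lo_mul_gr {S : Subalgebra F (MvPolynomial ι F)} (hS : IsGr S) {D : ℕ} (d : ℕ)
    {p : MvPolynomial ι F} (hp : p ∈ loPart S D * Subalgebra.toSubmodule S) :
    homogeneousComponent d p ∈ loPart S D * Subalgebra.toSubmodule S :=
  lo_mul_homComp hS (fun _ h1 h2 _ => mul_le_mul' (subComp_le_loPart S h1 h2) (subComp_le S _)) hp

/-- The recursion for the upper bound. -/
lemma step_upper {S : Subalgebra F (MvPolynomial ι F)} (hS : IsGr S) {D C k b : ℕ}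
    (hC : ∀ d, C < d → subComp S d ≤ loPart S D * Subalgebra.toSubmodule S)
    (hb : ∀ d, b < d → subComp S d ≤ subPos S ^ (k + 1)) :
    ∀ d, C < d → b + D < d → subComp S d ≤ subPos S ^ (k + 2) := by
  intro d h1 h2
  refine subComp_le_of_lo hS (fun j hj1 hj2 hj3 => ?_) (hC d h1)
  rw [pow_succ' _ (k + 1)]
  exact mul_le_mul' (subComp_le_subPos S hj1) (hb _ (by omega))

lemma upper {S : Subalgebra F (MvPolynomial ι F)} (hS : IsGr S) {D C : ℕ}
    (hC : ∀ d, C < d → subComp S d ≤ loPart S D * Subalgebra.toSubmodule S) (k : ℕ) :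
    ∀ d, k * D + C < d → subComp S d ≤ subPos S ^ (k + 1) := by
  induction k with
  | zero =>
    intro d hd
    simpa using subComp_le_subPos S (by omega)
  | succ k ih =>
    intro d hd
    rw [add_mul, one_mul] at hd
    exact step_upper hS hC ih d (by nlinarith) (by omega)

lemma toSub_le_iSup {S : Subalgebra F (MvPolynomial ι F)} (hS : IsGr S)
    {X : Submodule F (MvPolynomial ι F)} (h : ∀ d, subComp S d ≤ X) :
    Subalgebra.toSubmodule S ≤ X := by
  intro p hp
  rw [← sum_homogeneousComponent p]
  exact X.sum_mem fun i _ => h i (mem_subComp.2 ⟨hS p hp _, homogeneousComponent_isHomogeneous _ _⟩)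

lemma fgOver_of_large [Finite ι] {S : Subalgebra F (MvPolynomial ι F)} (hS : IsGr S) {D N : ℕ}
    (h : ∀ d, N < d → subComp S d ≤ loPart S D * Subalgebra.toSubmodule S) :
    fgOver S (Algebra.adjoin F (⋃ i ∈ Set.Iic D, (subComp S i : Set (MvPolynomial ι F)))) := by
  classical
  have hfg : (⨆ d ∈ Finset.range (N + 1), subComp S d).FG := by
    refine Submodule.fg_biSup _ _ fun d _ => ?_
    exact Submodule.FG.of_le (homogeneousSubmodule_fg ι F d) (subComp_le_hom S d)
  obtain ⟨B, hB⟩ := hfg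
  refine ⟨B, ?_, ?_⟩
  · have : Submodule.span F (B : Set (MvPolynomial ι F)) ≤ Subalgebra.toSubmodule S := by
      rw [hB]; exact iSup₂_le fun d _ => subComp_le S d
    exact Submodule.span_le.1 this
  · set T := Algebra.adjoin F (⋃ i ∈ Set.Iic D, (subComp S i : Set (MvPolynomial ι F))) with hT
    refine toSub_le_iSup hS fun d => ?_
    induction d using Nat.strong_induction_on with
    | _ d ih =>
      by_cases hd : d ≤ N
      · have h1 : subComp S d ≤ Submodule.span F (B : Set (MvPolynomial ι F)) := by
          rw [hB]; exact le_iSup₂_of_le d (Finset.mem_range.2 (by omega)) le_rfl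
        intro p hp
        have := Submodule.mul_mem_mul ((Subalgebra.mem_toSubmodule T).2 T.one_mem) (h1 hp)
        rwa [one_mul] at this
      · refine subComp_le_of_lo hS (fun j hj1 hj2 hj3 => ?_) (h d (by omega))
        have h1 : subComp S j ≤ Subalgebra.toSubmodule T := by
          intro p hp
          refine Algebra.subset_adjoin ?_
          exact Set.mem_biUnion (x := j) hj2 hp
        refine (mul_le_mul' h1 (ih (d - j) (by omega))).trans ?_
        rw [← mul_assoc]
        exact mul_le_mul' (toSub_mul T) le_rfl

lemma subComp_zero_le (S : Subalgebra F (MvPolynomial ι F)) : subComp S 0 ≤ 1 := by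
  refine (subComp_le_hom S 0).trans ?_
  rw [homogeneousSubmodule_zero]

lemma large_of_fgOver {S : Subalgebra F (MvPolynomial ι F)} (hS : IsGr S) {D : ℕ}
    (h : fgOver S (Algebra.adjoin F (⋃ i ∈ Set.Iic D, (subComp S i : Set (MvPolynomial ι F))))) :
    ∃ C, ∀ d, C < d → subComp S d ≤ loPart S D * Subalgebra.toSubmodule S := by
  classical
  obtain ⟨B, hBS, hB⟩ := h
  set Sm := Subalgebra.toSubmodule S with hSm
  set L := loPart S D with hL
  refine ⟨B.sup totalDegree, fun d hd => ?_⟩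
  have h1S : (1 : Submodule F (MvPolynomial ι F)) ≤ Sm := by
    rw [Submodule.one_le]; exact S.one_mem
  have hLL : L * Sm * (L * Sm) ≤ L * Sm := by
    rw [mul_assoc]
    refine mul_le_mul' le_rfl ?_
    exact (mul_le_mul' le_rfl ((mul_le_mul' (loPart_le S D) le_rfl).trans (toSub_mul S))).trans
      (toSub_mul S)
  have hmul : (1 ⊔ L * Sm) * (1 ⊔ L * Sm) ≤ 1 ⊔ L * Sm := by
    rw [Submodule.sup_mul, Submodule.mul_sup, Submodule.mul_sup]
    simp only [one_mul, mul_one]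
    refine sup_le le_rfl (sup_le le_sup_right (hLL.trans le_sup_right))
  have hT : Subalgebra.toSubmodule (Algebra.adjoin F
      (⋃ i ∈ Set.Iic D, (subComp S i : Set (MvPolynomial ι F)))) ≤ 1 ⊔ L * Sm := by
    intro p hp
    induction hp using Algebra.adjoin_induction with
    | mem x hx =>
      simp only [Set.mem_iUnion, exists_prop] at hx
      obtain ⟨i, hi, hx⟩ := hx
      rcases Nat.eq_zero_or_pos i with rfl | h0
      · exact Submodule.mem_sup_left (subComp_zero_le S hx)
      · refine Submodule.mem_sup_right ?_
        have := Submodule.mul_mem_mul (subComp_le_loPart S h0 hi hx) (h1S (Submodule.one_le.1 le_rfl))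
        rwa [mul_one] at this
    | algebraMap r => exact Submodule.mem_sup_left (Submodule.algebraMap_mem r)
    | add x y _ _ hx hy => exact Submodule.add_mem _ hx hy
    | mul x y _ _ hx hy => exact hmul (Submodule.mul_mem_mul hx hy)
  have hle : Sm ≤ Submodule.span F (B : Set (MvPolynomial ι F)) ⊔ L * Sm := by
    refine hB.trans ((mul_le_mul' hT le_rfl).trans ?_)
    rw [Submodule.sup_mul, one_mul]
    refine sup_le_sup le_rfl ?_
    rw [mul_assoc]
    exact mul_le_mul' le_rfl ((mul_le_mul' le_rfl (Submodule.span_le.2 hBS)).trans (toSub_mul S))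
  intro p hp
  obtain ⟨a, ha, b, hb, rfl⟩ := Submodule.mem_sup.1 (hle (subComp_le S d hp))
  have ha0 : homogeneousComponent d a = 0 := by
    have : Submodule.span F (B : Set (MvPolynomial ι F)) ≤
        LinearMap.ker (homogeneousComponent d) := by
      rw [Submodule.span_le]
      intro x hx
      exact homogeneousComponent_eq_zero _ _ (lt_of_le_of_lt (Finset.le_sup (f := totalDegree) hx) hd)
    exact this ha
  rw [← homogeneousComponent_eq_self (mem_subComp.1 hp).2, map_add, ha0, zero_add]
  exact lo_mul_gr hS d hb

/-- The lower bound. -/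
lemma lower [Finite ι] {S : Subalgebra F (MvPolynomial ι F)} (hS : IsGr S) {k s : ℕ}
    (hs : sigmaAlg S = s + 1) 
    (h : ∀ d, (k + 1) * (s + 1) ≤ d → subComp S d ≤ subPos S ^ (k + 2)) : False := by
  set M := subPos S with hM
  set Sm := Subalgebra.toSubmodule S with hSm
  set J := loPart S s with hJ
  have hJS : J ≤ Sm := loPart_le S s
  have h1 : ∀ m, M ^ (m + 1) ≤ J * Sm ⊔ hiPart S (s + 1) ^ (m + 1) := by
    have hJ1 : J ≤ J * Sm := by
      have : (1 : Submodule F (MvPolynomial ι F)) ≤ Sm := by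
        rw [Submodule.one_le]; exact S.one_mem
      simpa using mul_le_mul' (le_refl J) this
    have hhS : hiPart S (s + 1) ≤ Sm := iSup₂_le fun d _ => subComp_le S d
    have hMS : M ≤ Sm := subPos_le S
    intro m
    induction m with
    | zero =>
      simp only [zero_add, pow_one]
      exact (subPos_le_sup S s).trans (sup_le_sup hJ1 le_rfl)
    | succ m ih =>
      rw [pow_succ, pow_succ _ (m + 1)]
      refine (mul_le_mul' ih le_rfl).trans ?_
      rw [Submodule.sup_mul]
      refine sup_le ?_ ?_
      · rw [mul_assoc]
        exact (mul_le_mul' le_rfl ((mul_le_mul' le_rfl hMS).trans (toSub_mul S))).trans le_sup_left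
      · refine (mul_le_mul' le_rfl (subPos_le_sup S s)).trans ?_
        rw [Submodule.mul_sup]
        refine sup_le_sup ?_ le_rfl
        rw [mul_comm]
        refine mul_le_mul' le_rfl ?_
        have hp : ∀ m, hiPart S (s + 1) ^ (m + 1) ≤ Sm := by
          intro m
          refine (hiPart_pow S _ _).trans (iSup₂_le fun d _ => subComp_le S d)
        exact hp m
  have h2 : M ^ (k + 1) ≤ J * Sm ⊔ M ^ (k + 2) := by
    refine (h1 k).trans (sup_le_sup le_rfl ((hiPart_pow S _ _).trans ?_))
    exact iSup₂_le fun d hd => h d hd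
  have hMS : M ≤ Sm := subPos_le S
  have h3 : ∀ N, M ^ (k + 1) ≤ J * Sm ⊔ M ^ (k + 1 + N) := by
    intro N
    induction N with
    | zero => exact le_sup_right
    | succ N ih =>
      refine ih.trans (sup_le le_sup_left ?_)
      have : M ^ (k + 1 + N) ≤ J * Sm ⊔ M ^ (k + 1 + (N + 1)) := by
        clear ih
        induction N with
        | zero => exact h2
        | succ N ih =>
          rw [← add_assoc, pow_succ]
          refine (mul_le_mul' ih le_rfl).trans ?_
          rw [Submodule.sup_mul, mul_assoc]
          refine sup_le_sup (mul_le_mul' le_rfl ((mul_le_mul' le_rfl hMS).trans (toSub_mul S))) ?_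
          rw [← pow_succ]
          exact le_of_eq (by congr 1)
      exact this
  have h4 : ∀ d, (k + 1) * (s + 1) < d → subComp S d ≤ loPart S s * Subalgebra.toSubmodule S := by
    intro d hd p hp
    have hp1 := h3 d (subPos_pow_succ_le S k (h d hd.le hp))
    obtain ⟨a, ha, b, hb, rfl⟩ := Submodule.mem_sup.1 hp1
    have hb0 : homogeneousComponent d b = 0 := by
      have hb' : b ∈ hiPart S (d + 1) := by
        have e : k + 1 + d = (k + d) + 1 := by ring
        rw [e] at hb
        have := hiPart_pow S 1 (k + d) hb
        have hle : hiPart S ((k + d + 1) * 1) ≤ hiPart S (d + 1) :=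
          iSup₂_le fun i hi => subComp_le_hiPart S (by simp only [Set.mem_Ici] at hi; omega)
        exact hle this
      have : hiPart S (d + 1) ≤ LinearMap.ker (homogeneousComponent d) := by
        refine iSup₂_le fun i hi => ?_
        intro x hx
        rw [LinearMap.mem_ker, homogeneousComponent_of_mem (subComp_le_hom S i hx), if_neg]
        simp only [Set.mem_Ici] at hi
        omega
      exact this hb'
    rw [← homogeneousComponent_eq_self (mem_subComp.1 hp).2, map_add, hb0, add_zero]
    exact lo_mul_gr hS d ha
  have h5 := fgOver_of_large hS h4
  have h6 : sigmaAlg S ≤ s := Nat.sInf_le h5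
  omega

end Abstract

section Polar

lemma coeff_mem_of_forall {F A : Type*} [Field F] [Infinite F] [AddCommGroup A] [Module F A]
    (Q : Submodule F A) (m : ℕ) (a : ℕ → A)
    (h : ∀ t : F, ∑ i ∈ Finset.range m, t ^ i • a i ∈ Q) (i : ℕ) (hi : i < m) : a i ∈ Q := by
  rw [← Submodule.Quotient.mk_eq_zero, ← Module.forall_dual_apply_eq_zero_iff F]
  intro f
  set P : Polynomial F := ∑ i ∈ Finset.range m,
    Polynomial.monomial i (f (Submodule.Quotient.mk (a i))) with hP
  have hP0 : P = 0 := by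
    refine Polynomial.funext fun t => ?_
    have h1 := h t
    rw [← Submodule.Quotient.mk_eq_zero] at h1
    have h2 := congrArg f h1
    rw [← Submodule.mkQ_apply, map_sum, map_sum, map_zero] at h2
    rw [hP, Polynomial.eval_finsetSum, Polynomial.eval_zero, ← h2]
    refine Finset.sum_congr rfl fun i _ => ?_
    rw [map_smul, map_smul, Polynomial.eval_monomial, smul_eq_mul, mul_comm, Submodule.mkQ_apply]
  have h3 := congrArg (fun p => Polynomial.coeff p i) hP0
  simp only [hP, Polynomial.finsetSum_coeff, Polynomial.coeff_monomial, Polynomial.coeff_zero,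
    Finset.sum_ite_eq', Finset.mem_range, hi, if_true] at h3
  exact h3

lemma polar {F A : Type*} [Field F] [CharZero F] [CommRing A] [Algebra F A]
    (Q W : Submodule F A) (N : ℕ) (h : ∀ w ∈ W, w ^ N ∈ Q) : W ^ N ≤ Q := by
  have key : ∀ k, k ≤ N → ∀ p ∈ W ^ k, ∀ u ∈ W, p * u ^ (N - k) ∈ Q := by
    intro k
    induction k with
    | zero =>
      intro _ p hp u hu
      rw [pow_zero, Submodule.mem_one] at hp
      obtain ⟨c, rfl⟩ := hp
      rw [← Algebra.smul_def]
      exact Q.smul_mem _ (h u hu)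
    | succ k ih =>
      intro hk p hp u hu
      rw [pow_succ] at hp
      induction hp using Submodule.mul_induction_on' with
      | mem_mul_mem a ha w hw =>
        obtain ⟨m, hm⟩ : ∃ m, N - k = m + 1 := ⟨N - k - 1, by omega⟩
        have hm' : N - (k + 1) = m := by omega
        rw [hm']
        have h1 := coeff_mem_of_forall Q (m + 1 + 1)
          (fun i => a * (w ^ i * u ^ (m + 1 - i) * ((m + 1).choose i : A))) (fun t => by
            have h2 := ih (by omega) a ha (t • w + u) (W.add_mem (W.smul_mem t hw) hu)
            rw [hm, add_pow, Finset.mul_sum] at h2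
            convert h2 using 2 with i _
            rw [smul_pow]
            simp only [smul_mul_assoc, mul_smul_comm]) 1 (by omega)
        simp only [pow_one, Nat.choose_one_right, Nat.add_sub_cancel] at h1
        have h3 : a * (w * u ^ m * ((m + 1 : ℕ) : A)) = ((m + 1 : ℕ) : F) • (a * w * u ^ m) := by
          rw [Algebra.smul_def, map_natCast]; ring
        rw [h3] at h1
        have h4 := Q.smul_mem (((m + 1 : ℕ) : F)⁻¹) h1
        rwa [smul_smul, inv_mul_cancel₀ (Nat.cast_ne_zero.2 (Nat.succ_ne_zero m)), one_smul] at h4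
      | add x _ y _ hx hy => rw [add_mul]; exact Q.add_mem hx hy
  intro p hp
  simpa using key N le_rfl p hp 0 W.zero_mem

end Polar

section Rep

variable {F : Type*} [Field F] {G : Type*} [Group G] {ι : Type*}
    [Fintype ι] [DecidableEq ι] (ρ : Representation F G (ι → F))

lemma polyAct_X (g : G) (i : ι) :
    polyAct ρ g (X i) = ∑ j, (ρ g (Pi.single j 1) i) • MvPolynomial.X j := by
  simp [polyAct]

lemma polyAct_one (p : MvPolynomial ι F) : polyAct ρ 1 p = p := by
  have : polyAct ρ 1 = AlgHom.id F _ := by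
    refine MvPolynomial.algHom_ext fun i => ?_
    rw [polyAct_X]
    simp [Pi.single_apply, ite_smul]
  rw [this]; rfl

lemma polyAct_mul (g h : G) (p : MvPolynomial ι F) :
    polyAct ρ (g * h) p = polyAct ρ h (polyAct ρ g p) := by
  have : polyAct ρ (g * h) = (polyAct ρ h).comp (polyAct ρ g) := by
    refine MvPolynomial.algHom_ext fun i => ?_
    rw [AlgHom.comp_apply, polyAct_X, polyAct_X, map_sum]
    simp only [map_smul, polyAct_X, Finset.smul_sum, smul_smul]
    rw [Finset.sum_comm]
    refine Finset.sum_congr rfl fun k _ => ?_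
    rw [← Finset.sum_smul]
    congr 1
    rw [map_mul, Module.End.mul_apply]
    have h1 := pi_eq_sum_univ' (ρ h (Pi.single k 1))
    conv_lhs => rw [h1]
    rw [map_sum, Finset.sum_apply]
    refine Finset.sum_congr rfl fun j _ => ?_
    rw [map_smul, Pi.smul_apply, smul_eq_mul, mul_comm]
  rw [this]; rfl

lemma polyAct_homog (g : G) {d : ℕ} {p : MvPolynomial ι F} (hp : p.IsHomogeneous d) :
    (polyAct ρ g p).IsHomogeneous d := by
  have := hp.aeval (n := 1) (fun i => ∑ j, (ρ g (Pi.single j 1) i) • (X j : MvPolynomial ι F))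
    (fun i => IsHomogeneous.sum _ _ _ fun j _ => by
      rw [smul_eq_C_mul]; exact isHomogeneous_C_mul_X _ _)
  rwa [one_mul] at this

lemma mem_invRing {p : MvPolynomial ι F} : p ∈ invRing ρ ↔ ∀ g, polyAct ρ g p = p := by
  simp [invRing, Algebra.mem_iInf, AlgHom.mem_equalizer]

lemma homComp_comm {τ : Type*} (f : MvPolynomial ι F →ₗ[F] MvPolynomial τ F)
    (hf : ∀ d p, p.IsHomogeneous d → (f p).IsHomogeneous d) (d : ℕ) (p : MvPolynomial ι F) :
    homogeneousComponent d (f p) = f (homogeneousComponent d p) := by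
  conv_lhs => rw [← sum_homogeneousComponent p, map_sum, map_sum]
  have h1 : ∀ i, homogeneousComponent d (f (homogeneousComponent i p)) =
      if d = i then f (homogeneousComponent i p) else 0 := by
    intro i
    have := hf i _ (homogeneousComponent_isHomogeneous i p)
    rw [homogeneousComponent_of_mem this]
  simp only [h1, Finset.sum_ite_eq, Finset.mem_range]
  split_ifs with h
  · rfl
  · rw [homogeneousComponent_eq_zero _ _ (by omega), map_zero]

lemma invRing_gr : IsGr (invRing ρ) := by
  intro p hp d
  rw [mem_invRing] at *
  intro g
  have := homComp_comm (polyAct ρ g).toLinearMap (fun d p hp => polyAct_homog ρ g hp) d p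
  simp only [AlgHom.toLinearMap_apply, hp g] at this
  exact this.symm

/-- Noether/Benson: powers of linear forms lie in the Hilbert ideal. -/
lemma pow_card_mem [Fintype G] (x : MvPolynomial ι F) (hx : x.IsHomogeneous 1) :
    x ^ Fintype.card G ∈ loPart (invRing ρ) (Fintype.card G) *
      (⊤ : Submodule F (MvPolynomial ι F)) := by
  classical
  set n := Fintype.card G with hn
  set f : G → MvPolynomial ι F := fun g => polyAct ρ g x with hf
  have hc : ∀ j, (Finset.univ.val.map f).esymm j ∈ subComp (invRing ρ) j := by
    intro j
    rw [← aeval_esymm_eq_multiset_esymm G F]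
    rw [mem_subComp, mem_invRing]
    constructor
    · intro h
      have h1 : polyAct ρ h (aeval f (esymm G F j)) =
          aeval (fun g => polyAct ρ h (f g)) (esymm G F j) := by
        rw [← AlgHom.comp_apply, comp_aeval]
      have h2 : (fun g => polyAct ρ h (f g)) = f ∘ (Equiv.mulRight h) := by
        funext g
        simp [hf, polyAct_mul]
      rw [h1, h2, ← aeval_rename, rename_esymm]
    · have he : (esymm G F j).IsHomogeneous j := by
        unfold esymm
        refine IsHomogeneous.sum _ _ _ fun s hs => ?_
        have := IsHomogeneous.prod s (fun i => (X i : MvPolynomial G F)) (fun _ => 1)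
          (fun i _ => isHomogeneous_X _ _)
        rw [Finset.mem_powersetCard] at hs
        simpa [hs.2] using this
      have := he.aeval f (n := 1) (fun g => polyAct_homog ρ g hx)
      rwa [one_mul] at this
  have h0 := congrArg (Polynomial.eval x)
    (Multiset.prod_X_sub_X_eq_sum_esymm (Finset.univ.val.map f))
  have hl : Polynomial.eval x ((Finset.univ.val.map f).map
      fun t => Polynomial.X - Polynomial.C t).prod = 0 := by
    rw [Polynomial.eval_multiset_prod]
    apply Multiset.prod_eq_zero
    simp only [Multiset.map_map, Multiset.mem_map]
    refine ⟨1, Finset.mem_univ_val _, ?_⟩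
    simp [hf, polyAct_one]
  rw [hl, Multiset.card_map] at h0
  have hcard : Multiset.card (Finset.univ (α := G)).val = n := rfl
  rw [hcard, Finset.sum_range_succ', Polynomial.eval_add, Polynomial.eval_finsetSum] at h0
  simp only [pow_zero, Multiset.esymm, Multiset.powersetCard_zero_left, Nat.sub_zero, one_mul,
    Polynomial.eval_mul, Polynomial.eval_pow, Polynomial.eval_X, Polynomial.eval_C,
    Multiset.map_singleton, Multiset.prod_zero, Multiset.sum_singleton] at h0
  have h1 := eq_neg_of_add_eq_zero_right h0.symm
  rw [h1]
  refine Submodule.neg_mem _ (Submodule.sum_mem _ fun j hj => ?_)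
  rw [Finset.mem_range] at hj
  have h2 := subComp_le_loPart (invRing ρ) (d := j + 1) (D := n) (by omega) (by omega) (hc (j + 1))
  have h3 := Submodule.mul_mem_mul h2 (Submodule.mem_top (R := F)
    (x := (Polynomial.eval x (-1)) ^ (j + 1) * x ^ (n - (j + 1))))
  convert h3 using 1
  simp only [Multiset.esymm]
  ring

/-- Reynolds operator. -/
lemma reynolds [CharZero F] [Fintype G] {D : ℕ} {p : MvPolynomial ι F} (hp : p ∈ invRing ρ)
    (h : p ∈ loPart (invRing ρ) D * (⊤ : Submodule F (MvPolynomial ι F))) :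
    p ∈ loPart (invRing ρ) D * Subalgebra.toSubmodule (invRing ρ) := by
  set R : MvPolynomial ι F →ₗ[F] MvPolynomial ι F := ∑ g : G, (polyAct ρ g).toLinearMap with hR
  have hRS : ∀ q, R q ∈ invRing ρ := by
    intro q
    rw [mem_invRing]
    intro g
    simp only [hR, LinearMap.sum_apply, AlgHom.toLinearMap_apply, map_sum, ← polyAct_mul]
    exact Fintype.sum_equiv (Equiv.mulRight g) _ _ fun _ => rfl
  have hmul : ∀ s ∈ invRing ρ, ∀ q, R (s * q) = s * R q := by
    intro s hs q
    rw [mem_invRing] at hs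
    simp [hR, LinearMap.sum_apply, hs, Finset.mul_sum]
  have hle : loPart (invRing ρ) D * (⊤ : Submodule F (MvPolynomial ι F)) ≤
      (loPart (invRing ρ) D * Subalgebra.toSubmodule (invRing ρ)).comap R := by
    rw [Submodule.mul_le]
    intro s hs q _
    rw [Submodule.mem_comap, hmul s (loPart_le _ _ hs)]
    exact Submodule.mul_mem_mul hs (hRS q)
  have h1 := hle h
  rw [Submodule.mem_comap] at h1
  have h2 : R p = (Fintype.card G : F) • p := by
    rw [mem_invRing] at hp
    simp [hR, LinearMap.sum_apply, hp, Nat.cast_smul_eq_nsmul]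
  rw [h2] at h1
  have h4 := Submodule.smul_mem _ ((Fintype.card G : F)⁻¹) h1
  rwa [smul_smul, inv_mul_cancel₀ (Nat.cast_ne_zero.2 Fintype.card_ne_zero), one_smul] at h4

lemma large_of_pow [CharZero F] [Fintype G] {D N : ℕ}
    (h : ∀ x : MvPolynomial ι F, x.IsHomogeneous 1 →
      x ^ N ∈ loPart (invRing ρ) D * (⊤ : Submodule F (MvPolynomial ι F))) :
    ∀ d, N < d → subComp (invRing ρ) d ≤
      loPart (invRing ρ) D * Subalgebra.toSubmodule (invRing ρ) := by
  intro d hd p hp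
  have h1 := polar _ (homogeneousSubmodule ι F 1) N h
  refine reynolds ρ (subComp_le _ _ hp) ?_
  have h2 : homogeneousSubmodule ι F d ≤
      loPart (invRing ρ) D * (⊤ : Submodule F (MvPolynomial ι F)) := by
    rw [← homogeneousSubmodule_one_pow, ← Nat.add_sub_cancel' hd.le, pow_add]
    refine (mul_le_mul' h1 le_top).trans ?_
    rw [mul_assoc]
    exact mul_le_mul' le_rfl le_top
  exact h2 (subComp_le_hom _ _ hp)

lemma fgOver_sigma [CharZero F] [Fintype G] :
    fgOver (invRing ρ) (Algebra.adjoin F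
      (⋃ i ∈ Set.Iic (sigmaAlg (invRing ρ)), (subComp (invRing ρ) i : Set (MvPolynomial ι F)))) :=
  Nat.sInf_mem (s := {d : ℕ | fgOver (invRing ρ)
    (Algebra.adjoin F (⋃ i ∈ Set.Iic d, (subComp (invRing ρ) i : Set (MvPolynomial ι F))))})
    ⟨Fintype.card G, fgOver_of_large (invRing_gr ρ) (large_of_pow ρ (pow_card_mem ρ))⟩

end Rep

section Reg

variable (F : Type*) [Field F] (G : Type*) [Group G] [Fintype G]

/-- The regular representation, on `Fin |G| → F`. -/
noncomputable def regRep : Representation F G (Fin (Fintype.card G) → F) where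
  toFun h := LinearMap.funLeft F F
    (fun i => Fintype.equivFin G ((Fintype.equivFin G).symm i * h))
  map_one' := by
    ext v i
    simp [LinearMap.funLeft]
  map_mul' g h := by
    ext v i
    simp [LinearMap.funLeft, mul_assoc]

variable {F G}

lemma polyAct_reg_X (h : G) (i : Fin (Fintype.card G)) :
    polyAct (regRep F G) h (X i) = X (Fintype.equivFin G ((Fintype.equivFin G).symm i * h)) := by
  rw [polyAct_X]
  simp [regRep, LinearMap.funLeft_apply, Pi.single_apply, ite_smul]

variable {ι : Type*} [Fintype ι] [DecidableEq ι] (ρ : Representation F G (ι → F))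

/-- The equivariant map from the coordinate ring of the regular representation. -/
noncomputable def regMap (x : MvPolynomial ι F) :
    MvPolynomial (Fin (Fintype.card G)) F →ₐ[F] MvPolynomial ι F :=
  aeval (fun i => polyAct ρ ((Fintype.equivFin G).symm i) x)

lemma regMap_equiv (x : MvPolynomial ι F) (h : G) (p : MvPolynomial (Fin (Fintype.card G)) F) :
    regMap ρ x (polyAct (regRep F G) h p) = polyAct ρ h (regMap ρ x p) := by
  have : (regMap ρ x).comp (polyAct (regRep F G) h) = (polyAct ρ h).comp (regMap ρ x) := by
    refine MvPolynomial.algHom_ext fun i => ?_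
    simp only [AlgHom.comp_apply, polyAct_reg_X]
    simp [regMap, polyAct_mul]
  exact DFunLike.congr_fun this p

lemma regMap_X (x : MvPolynomial ι F) : regMap ρ x (X (Fintype.equivFin G 1)) = x := by
  simp [regMap, polyAct_one]

lemma regMap_lo {x : MvPolynomial ι F} (hx : x.IsHomogeneous 1) (D : ℕ)
    {p : MvPolynomial (Fin (Fintype.card G)) F}
    (hp : p ∈ loPart (invRing (regRep F G)) D * (⊤ : Submodule F _)) :
    regMap ρ x p ∈ loPart (invRing ρ) D * (⊤ : Submodule F (MvPolynomial ι F)) := by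
  have h1 : loPart (invRing (regRep F G)) D ≤
      (loPart (invRing ρ) D).comap (regMap ρ x).toLinearMap := by
    refine iSup₂_le fun d hd => ?_
    intro q hq
    refine subComp_le_loPart (invRing ρ) hd.1 hd.2 ?_
    rw [mem_subComp, mem_invRing] at *
    refine ⟨fun g => ?_, ?_⟩
    · rw [AlgHom.toLinearMap_apply, ← regMap_equiv, hq.1 g]
    · have := hq.2.aeval (n := 1) (fun i => polyAct ρ ((Fintype.equivFin G).symm i) x)
        (fun i => polyAct_homog ρ _ hx)
      rwa [one_mul] at this
  have h2 : loPart (invRing (regRep F G)) D * (⊤ : Submodule F _) ≤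
      (loPart (invRing ρ) D * (⊤ : Submodule F (MvPolynomial ι F))).comap
        (regMap ρ x).toLinearMap := by
    rw [Submodule.mul_le]
    intro a ha b _
    rw [Submodule.mem_comap, AlgHom.toLinearMap_apply, map_mul]
    exact Submodule.mul_mem_mul (h1 ha) Submodule.mem_top
  exact h2 hp

variable [CharZero F]

variable (F G) in
lemma uniform_bound : ∃ C, ∀ (n : ℕ) (ρ : Representation F G (Fin n → F)) (d : ℕ), C < d →
    subComp (invRing ρ) d ≤ loPart (invRing ρ) (sigmaAlg (invRing (regRep F G))) *
      Subalgebra.toSubmodule (invRing ρ) := by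
  obtain ⟨C, hC⟩ := large_of_fgOver (invRing_gr (regRep F G)) (fgOver_sigma (regRep F G))
  set R := invRing (regRep F G) with hR
  refine ⟨Fintype.card G * (C + 1), fun n ρ => large_of_pow ρ fun x hx => ?_⟩
  set y : MvPolynomial (Fin (Fintype.card G)) F := X (Fintype.equivFin G 1) with hy
  have h1 : y ^ Fintype.card G ∈ subPos R * (⊤ : Submodule F _) :=
    mul_le_mul' (loPart_le_subPos _ _) le_rfl (pow_card_mem (regRep F G) y (isHomogeneous_X _ _))
  have h2 : y ^ (Fintype.card G * (C + 1)) ∈ loPart R (sigmaAlg R) * (⊤ : Submodule F _) := by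
    rw [pow_mul]
    have h3 := Submodule.pow_mem_pow _ h1 (C + 1)
    rw [mul_pow] at h3
    have h4 : subPos R ^ (C + 1) ≤ loPart R (sigmaAlg R) * Subalgebra.toSubmodule R := by
      refine (hiPart_pow R 1 C).trans (iSup₂_le fun d hd => hC d ?_)
      simp only [Set.mem_Ici] at hd
      omega
    have h5 := mul_le_mul' h4 (le_top (a := (⊤ : Submodule F
      (MvPolynomial (Fin (Fintype.card G)) F)) ^ (C + 1))) h3
    rw [mul_assoc] at h5
    exact (mul_le_mul' (le_refl (loPart R (sigmaAlg R))) le_top :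
      loPart R (sigmaAlg R) * (Subalgebra.toSubmodule R * ⊤) ≤ _ * ⊤) h5
  have h6 := regMap_lo ρ hx _ h2
  rwa [map_pow, hy, regMap_X] at h6

variable (F G) in
lemma sigma_reg_pos : sigmaAlg (invRing (regRep F G)) ≠ 0 := by
  intro h0
  have hfg := fgOver_sigma (regRep F G)
  rw [h0] at hfg
  obtain ⟨C, hC⟩ := large_of_fgOver (invRing_gr (regRep F G)) hfg
  have hlo : loPart (invRing (regRep F G)) 0 = ⊥ := by
    rw [eq_bot_iff]
    refine iSup₂_le fun d hd => ?_
    simp only [Set.mem_Icc] at hd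
    omega
  have h1 := hC (C + 1) (by omega)
  rw [hlo, Submodule.bot_mul] at h1
  have h2 : (∑ i, X i : MvPolynomial (Fin (Fintype.card G)) F) ^ (C + 1) ∈
      subComp (invRing (regRep F G)) (C + 1) := by
    rw [mem_subComp]
    constructor
    · refine Subalgebra.pow_mem _ ?_ _
      rw [mem_invRing]
      intro g
      rw [map_sum]
      simp only [polyAct_reg_X]
      exact Fintype.sum_equiv (((Fintype.equivFin G).symm.trans (Equiv.mulRight g)).trans
        (Fintype.equivFin G)) _ _ fun _ => rfl
    · have := (IsHomogeneous.sum Finset.univ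
        (fun i => (X i : MvPolynomial (Fin (Fintype.card G)) F)) 1
        (fun i _ => isHomogeneous_X _ _)).pow (C + 1)
      rwa [one_mul] at this
  have h3 := (Submodule.mem_bot F).1 (h1 h2)
  have h4 := congrArg (MvPolynomial.eval (fun _ => (1 : F))) h3
  simp at h4

lemma sigma_le_of {n : ℕ} (ρ : Representation F G (Fin n → F)) :
    sigmaAlg (invRing ρ) ≤ sigmaAlg (invRing (regRep F G)) := by
  obtain ⟨C, hC⟩ := uniform_bound F G
  exact Nat.sInf_le (fgOver_of_large (invRing_gr ρ) (hC n ρ))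

variable (F G) in
lemma sigmaGrp_eq : sigmaGrp F G = (sigmaAlg (invRing (regRep F G)) : ℕ∞) := by
  refine le_antisymm (iSup₂_le fun n ρ => Nat.cast_le.2 (sigma_le_of ρ)) ?_
  exact le_iSup₂_of_le (f := fun n (ρ : Representation F G (Fin n → F)) =>
    (sigmaAlg (invRing ρ) : ℕ∞)) _ (regRep F G) le_rfl

end Reg

lemma betaAlg_le_iff {F : Type*} [Field F] {ι : Type*}
    (S : Subalgebra F (MvPolynomial ι F)) (k B : ℕ) :
    betaAlg S k ≤ (B : ℕ∞) ↔ ∀ d, B < d → subComp S d ≤ subPos S ^ (k + 1) := by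
  unfold betaAlg
  rw [sSup_le_iff]
  constructor
  · intro h d hd
    by_contra hc
    have := h d ⟨d, ⟨by omega, hc⟩, rfl⟩
    rw [Nat.cast_le] at this
    omega
  · rintro h _ ⟨d, ⟨hd0, hd⟩, rfl⟩
    by_contra hc
    simp only [Nat.cast_le, not_le] at hc
    exact hd (h d hc)

lemma betaGrp_le_iff {F : Type*} [Field F] {G : Type*} [Group G] (k B : ℕ) :
    betaGrp F G k ≤ (B : ℕ∞) ↔ ∀ (n : ℕ) (ρ : Representation F G (Fin n → F)) (d : ℕ), B < d →
      subComp (invRing ρ) d ≤ subPos (invRing ρ) ^ (k + 1) := by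
  unfold betaGrp
  simp only [iSup_le_iff, betaAlg_le_iff]

lemma betaGrp_linear_aux {F : Type*} [Field F] [CharZero F]
    {G : Type*} [Group G] [Finite G] :
    ∃ s : ℕ, sigmaGrp F G = (s : ℕ∞) ∧ ∃ k₀ β₀ : ℕ, ∀ k : ℕ, k₀ ≤ k →
        betaGrp F G k = ((k * s + β₀ : ℕ) : ℕ∞) := by
  have := Fintype.ofFinite G
  obtain ⟨C, hC⟩ := uniform_bound F G
  obtain ⟨s, hs⟩ := Nat.exists_eq_succ_of_ne_zero (sigma_reg_pos F G)
  rw [Nat.succ_eq_add_one] at hs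
  rw [hs] at hC
  refine ⟨s + 1, by rw [sigmaGrp_eq, hs], ?_⟩
  have hfin : ∀ k, ∃ b : ℕ, betaGrp F G k = (b : ℕ∞) := by
    intro k
    have h1 : betaGrp F G k ≤ ((k * (s + 1) + C : ℕ) : ℕ∞) := by
      rw [betaGrp_le_iff]
      exact fun n ρ => upper (invRing_gr ρ) (hC n ρ) k
    obtain ⟨b, hb⟩ := ENat.ne_top_iff_exists.1 (ne_top_of_le_ne_top (ENat.natCast_ne_top _) h1)
    exact ⟨b, hb.symm⟩
  choose b hb using hfin
  have hlow : ∀ k, (k + 1) * (s + 1) ≤ b (k + 1) := by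
    intro k
    by_contra hc
    push Not at hc
    have h1 := (betaGrp_le_iff (F := F) (G := G) (k + 1) (b (k + 1))).1 (hb (k + 1)).le
    exact lower (invRing_gr (regRep F G)) hs
      (fun d hd => h1 _ (regRep F G) d (lt_of_lt_of_le hc hd))
  have hup : ∀ k, b (k + 1) ≤ max C (b k + (s + 1)) := by
    intro k
    have h1 := (betaGrp_le_iff (F := F) (G := G) k (b k)).1 (hb k).le
    have h2 : betaGrp F G (k + 1) ≤ ((max C (b k + (s + 1)) : ℕ) : ℕ∞) := by
      rw [betaGrp_le_iff]
      intro n ρ d hd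
      rw [max_lt_iff] at hd
      exact step_upper (invRing_gr ρ) (hC n ρ) (h1 n ρ) d hd.1 hd.2
    rw [hb (k + 1), Nat.cast_le] at h2
    exact h2
  have hstep : ∀ k, b (C + 1 + (k + 1)) - (C + 1 + (k + 1)) * (s + 1) ≤
      b (C + 1 + k) - (C + 1 + k) * (s + 1) := by
    intro k
    have h1 := hup (C + 1 + k)
    have h2 : (C + 1 + k) * (s + 1) ≤ b (C + 1 + k) := by
      have := hlow (C + k)
      rwa [show C + k + 1 = C + 1 + k by ring] at this
    have h3 : C ≤ b (C + 1 + k) + (s + 1) := by nlinarith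
    rw [max_eq_right h3] at h1
    rw [← add_assoc, add_mul (C + 1 + k) 1, one_mul]
    omega
  have hanti : Antitone (fun k => b (C + 1 + k) - (C + 1 + k) * (s + 1)) :=
    antitone_nat_of_succ_le hstep
  obtain ⟨m, hm⟩ := WellFoundedLT.antitone_chain_condition hanti
  refine ⟨C + 1 + m, b (C + 1 + m) - (C + 1 + m) * (s + 1), fun k hk => ?_⟩
  obtain ⟨j, rfl⟩ := Nat.exists_eq_add_of_le hk
  have h1 := hm (m + j) (by omega)
  have h1' : b (C + 1 + m) - (C + 1 + m) * (s + 1) =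
    b (C + 1 + (m + j)) - (C + 1 + (m + j)) * (s + 1) := h1
  have h2 : (C + 1 + (m + j)) * (s + 1) ≤ b (C + 1 + (m + j)) := by
    have := hlow (C + (m + j))
    rwa [show C + (m + j) + 1 = C + 1 + (m + j) by ring] at this
  rw [hb, h1', add_assoc (C + 1) m j, Nat.add_sub_cancel' h2]

/-- In characteristic zero, for a finite group `G` the function `β_k(G)` is eventually linear
in `k` with slope `σ(G)`; in particular `β_k(G)/k → σ(G)` as `k → ∞`. -/
theorem betaGrp_eventually_linear {F : Type*} [Field F] [CharZero F]
    {G : Type*} [Group G] [Finite G] :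
    (∃ k₀ β₀ : ℕ, ∀ k : ℕ, k₀ ≤ k →
        betaGrp F G k = (k : ℕ∞) * sigmaGrp F G + (β₀ : ℕ∞)) ∧
      Filter.Tendsto (fun k : ℕ => (betaGrp F G k : ℝ≥0∞) / (k : ℝ≥0∞)) Filter.atTop
        (nhds (sigmaGrp F G : ℝ≥0∞)) := by
  obtain ⟨s, hs, k₀, β₀, h⟩ := betaGrp_linear_aux (F := F) (G := G)
  refine ⟨⟨k₀, β₀, fun k hk => by rw [h k hk, hs]; push_cast; rfl⟩, ?_⟩
  have h1 : Filter.Tendsto (fun k : ℕ => (s : ℝ≥0∞) + (β₀ : ℝ≥0∞) * (k : ℝ≥0∞)⁻¹) Filter.atTop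
      (nhds ((s : ℝ≥0∞) + (β₀ : ℝ≥0∞) * 0)) :=
    tendsto_const_nhds.add (ENNReal.Tendsto.const_mul ENNReal.tendsto_inv_nat_nhds_zero
      (Or.inr (ENNReal.natCast_ne_top _)))
  rw [mul_zero, add_zero] at h1
  have h2 : ((sigmaGrp F G : ℕ∞) : ℝ≥0∞) = (s : ℝ≥0∞) := by rw [hs]; simp
  rw [h2]
  refine h1.congr' ?_
  filter_upwards [Filter.eventually_ge_atTop (max k₀ 1)] with k hk
  have hk0 : (k : ℝ≥0∞) ≠ 0 := by
    have : 1 ≤ k := (le_max_right _ _).trans hk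
    exact_mod_cast (by omega : k ≠ 0)
  rw [h k ((le_max_left _ _).trans hk), ENat.toENNReal_coe, ENNReal.div_eq_inv_mul]
  push_cast
  rw [mul_add, ← mul_assoc, ENNReal.inv_mul_cancel hk0 (ENNReal.natCast_ne_top _), one_mul,
    mul_comm]
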